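/- Assume f : 𝒳ⁿ × ℝᵐ → ℝⁿ is Lipschitz on bounded sets with f(0,0) = 0. Suppose there exist constants L > 0 and p ∈ [0,1) such that for all φ, ψ ∈ 𝒳ⁿ and all v ∈ ℝᵐ: |f(φ,0) − f(ψ,0)| ≤ L‖φ − ψ‖ and |f(φ,v) − f(φ,0)| ≤ L max{‖φ‖ᵖ, 1}|v|. If the input-free system ẋ(t) = f(x_t, 0) is GES, then the system ẋ(t) = f(x_t, u(t)) is ISS. -/

import Mathlib

open Set Filter MeasureTheory Topology
open scoped NNReal

noncomputable section

/-- `ℝⁿ` with the Euclidean norm. -/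
abbrev Vec (n : ℕ) : Type := EuclideanSpace ℝ (Fin n)

/-- The state space `𝒳ⁿ = C([-Δ,0], ℝⁿ)`, equipped with the sup norm. -/
abbrev Hist (Δ : ℝ≥0) (n : ℕ) : Type :=
  ContinuousMap (Icc (-(Δ : ℝ)) (0 : ℝ)) (Vec n)

theorem zero_mem_IccD (Δ : ℝ≥0) : (0 : ℝ) ∈ Icc (-(Δ : ℝ)) (0 : ℝ) :=
  ⟨neg_nonpos.mpr Δ.coe_nonneg, le_refl 0⟩

/-- `φ(0)`: the current value of a history segment. -/
def ev0 {Δ : ℝ≥0} {n : ℕ} (φ : Hist Δ n) : Vec n :=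
  φ ⟨0, zero_mem_IccD Δ⟩

/-! ### Comparison functions -/

/-- Class `𝒦`: continuous, strictly increasing, zero at zero (on `[0,∞)`). -/
def ClassK (α : ℝ → ℝ) : Prop :=
  ContinuousOn α (Ici 0) ∧ StrictMonoOn α (Ici 0) ∧ α 0 = 0

/-- Class `𝒦∞`: class `𝒦` and unbounded. -/
def ClassKinf (α : ℝ → ℝ) : Prop :=
  ClassK α ∧ Tendsto α atTop atTop

/-- Class `𝒩`: continuous, nondecreasing, zero at zero (on `[0,∞)`). -/
def ClassN (α : ℝ → ℝ) : Prop :=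
  ContinuousOn α (Ici 0) ∧ MonotoneOn α (Ici 0) ∧ α 0 = 0

/-- Class `𝒫`: continuous, zero at zero, positive on `(0,∞)`. -/
def ClassP (α : ℝ → ℝ) : Prop :=
  ContinuousOn α (Ici 0) ∧ α 0 = 0 ∧ ∀ s : ℝ, 0 < s → 0 < α s

/-- Class `𝒦ℒ`. -/
def ClassKL (β : ℝ → ℝ → ℝ) : Prop :=
  (∀ t : ℝ, 0 ≤ t → ClassK fun s => β s t) ∧
    ∀ s : ℝ, 0 ≤ s →
      ContinuousOn (β s) (Ici 0) ∧ AntitoneOn (β s) (Ici 0) ∧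
        Tendsto (β s) atTop (𝓝 0)

/-! ### Inputs -/

/-- Admissible input: Lebesgue measurable and locally essentially bounded. -/
def IsInput {m : ℕ} (u : ℝ → Vec m) : Prop :=
  Measurable u ∧ ∀ T : ℝ, 0 < T → ∃ C : ℝ, ∀ᵐ t ∂volume, t ∈ Icc (0 : ℝ) T → ‖u t‖ ≤ C

/-- Essential supremum of `‖u‖` over a set of times. -/
def essBnd {m : ℕ} (u : ℝ → Vec m) (s : Set ℝ) : ℝ :=
  sInf {C : ℝ | 0 ≤ C ∧ ∀ᵐ τ ∂volume, τ ∈ s → ‖u τ‖ ≤ C}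

/-! ### History segments along a trajectory -/

-- The history segment `x_t ∈ 𝒳ⁿ` of a trajectory `x : ℝ → ℝⁿ` (with junk value `0`
-- when `x` is not continuous on `[t-Δ, t]`).
open Classical in
def seg (Δ : ℝ≥0) {n : ℕ} (x : ℝ → Vec n) (t : ℝ) : Hist Δ n :=
  if hx : ContinuousOn x (Icc (t - (Δ : ℝ)) t) then
    { toFun := fun τ => x (t + τ.1)
      continuous_toFun := by
        have h1 : Continuous fun τ : Icc (-(Δ : ℝ)) (0 : ℝ) => t + τ.1 :=
          continuous_const.add continuous_subtype_val
        have h2 : ∀ τ : Icc (-(Δ : ℝ)) (0 : ℝ), t + τ.1 ∈ Icc (t - (Δ : ℝ)) t := by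
          rintro ⟨τ, hτ⟩
          rw [mem_Icc] at hτ ⊢
          constructor
          · linarith [hτ.1]
          · linarith [hτ.2]
        exact hx.comp_continuous h1 h2 }
  else 0

/-! ### Driver's derivative and Dini derivative -/

/-- The deformed history `φ_{h,w}` appearing in Driver's derivative: for `0 ≤ h < Δ`,
`φ_{h,w}(s) = φ(s+h)` for `s ∈ [-Δ,-h)` and `φ_{h,w}(s) = φ(0) + w(h+s)` for `s ∈ [-h,0]`. -/
def shiftSeg {Δ : ℝ≥0} {n : ℕ} (φ : Hist Δ n) (w : Vec n) (h : ℝ) : Hist Δ n :=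
  { toFun := fun s =>
      φ (projIcc (-(Δ : ℝ)) 0 (neg_nonpos.mpr Δ.coe_nonneg) (s.1 + h)) + max (h + s.1) 0 • w
    continuous_toFun := by
      refine Continuous.add ?_ ?_
      · exact φ.continuous.comp (continuous_projIcc.comp
          (continuous_subtype_val.add continuous_const))
      · exact ((continuous_const.add continuous_subtype_val).max continuous_const).smul
          continuous_const }

/-- Driver's derivative `D⁺V(φ,w)`, valued in the extended reals. -/
def driverD {Δ : ℝ≥0} {n : ℕ} (V : Hist Δ n → ℝ) (φ : Hist Δ n) (w : Vec n) : EReal :=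
  limsup (fun h : ℝ => (((V (shiftSeg φ w h) - V φ) / h : ℝ) : EReal)) (𝓝[>] (0 : ℝ))

/-- Upper right-hand Dini derivative of `ν : ℝ → ℝ`, valued in the extended reals. -/
def diniD (ν : ℝ → ℝ) (t : ℝ) : EReal :=
  limsup (fun h : ℝ => (((ν (t + h) - ν t) / h : ℝ) : EReal)) (𝓝[>] (0 : ℝ))

/-! ### Lipschitz conditions -/

/-- `f : 𝒳ⁿ × ℝᵐ → ℝⁿ` is Lipschitz on bounded sets. -/
def LipOnBounded {Δ : ℝ≥0} {n m : ℕ} (f : Hist Δ n → Vec m → Vec n) : Prop :=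
  ∀ r : ℝ, 0 < r → ∃ L : ℝ, 0 < L ∧
    ∀ (φ₁ φ₂ : Hist Δ n) (v₁ v₂ : Vec m),
      ‖φ₁‖ ≤ r → ‖φ₂‖ ≤ r → ‖v₁‖ ≤ r → ‖v₂‖ ≤ r →
        ‖f φ₁ v₁ - f φ₂ v₂‖ ≤ L * (‖φ₁ - φ₂‖ + ‖v₁ - v₂‖)

/-- An input-free vector field `f₀ : 𝒳ⁿ → ℝⁿ` Lipschitz on bounded sets. -/
def LipOnBounded₀ {Δ : ℝ≥0} {n : ℕ} (f₀ : Hist Δ n → Vec n) : Prop :=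
  ∀ r : ℝ, 0 < r → ∃ L : ℝ, 0 < L ∧
    ∀ φ₁ φ₂ : Hist Δ n, ‖φ₁‖ ≤ r → ‖φ₂‖ ≤ r → ‖f₀ φ₁ - f₀ φ₂‖ ≤ L * ‖φ₁ - φ₂‖

/-- A functional `V : 𝒳ⁿ → ℝ` Lipschitz on bounded sets. -/
def LipOnBoundedV {Δ : ℝ≥0} {n : ℕ} (V : Hist Δ n → ℝ) : Prop :=
  ∀ r : ℝ, 0 < r → ∃ L : ℝ, 0 < L ∧
    ∀ φ₁ φ₂ : Hist Δ n, ‖φ₁‖ ≤ r → ‖φ₂‖ ≤ r → |V φ₁ - V φ₂| ≤ L * ‖φ₁ - φ₂‖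

/-- A functional `V : 𝒳ⁿ → ℝ` locally Lipschitz. -/
def LocallyLipV {Δ : ℝ≥0} {n : ℕ} (V : Hist Δ n → ℝ) : Prop :=
  ∀ φ : Hist Δ n, ∃ δ : ℝ, 0 < δ ∧ ∃ L : ℝ, 0 < L ∧
    ∀ φ₁ φ₂ : Hist Δ n, ‖φ₁ - φ‖ ≤ δ → ‖φ₂ - φ‖ ≤ δ → |V φ₁ - V φ₂| ≤ L * ‖φ₁ - φ₂‖

/-! ### Solutions -/

/-- `x` is a solution of `ẋ(t) = f(x_t, u(t))` with initial state `x₀` on `[0, tmax)`. -/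
structure IsSolution (Δ : ℝ≥0) {n m : ℕ} (f : Hist Δ n → Vec m → Vec n)
    (u : ℝ → Vec m) (x₀ : Hist Δ n) (tmax : EReal) (x : ℝ → Vec n) : Prop where
  tmax_pos : 0 < tmax
  cont : ContinuousOn x {s : ℝ | -(Δ : ℝ) ≤ s ∧ (s : EReal) < tmax}
  init : ∀ τ : Icc (-(Δ : ℝ)) (0 : ℝ), x τ.1 = x₀ τ
  integrable : ∀ t : ℝ, 0 ≤ t → (t : EReal) < tmax →
    IntervalIntegrable (fun s => f (seg Δ x s) (u s)) volume 0 t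
  integral_eq : ∀ t : ℝ, 0 ≤ t → (t : EReal) < tmax →
    x t = x 0 + ∫ s in (0:ℝ)..t, f (seg Δ x s) (u s)

/-- Maximal solution: a solution admitting no proper extension. -/
def IsMaxSolution (Δ : ℝ≥0) {n m : ℕ} (f : Hist Δ n → Vec m → Vec n)
    (u : ℝ → Vec m) (x₀ : Hist Δ n) (tmax : EReal) (x : ℝ → Vec n) : Prop :=
  IsSolution Δ f u x₀ tmax x ∧
    ∀ (tmax' : EReal) (x' : ℝ → Vec n), IsSolution Δ f u x₀ tmax' x' →
      (∀ t : ℝ, -(Δ : ℝ) ≤ t → (t : EReal) < tmax → x' t = x t) → tmax' ≤ tmax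

/-- Solution of the input-free system `ẋ(t) = f₀(x_t)`. -/
def IsSolution₀ (Δ : ℝ≥0) {n : ℕ} (f₀ : Hist Δ n → Vec n) (x₀ : Hist Δ n)
    (tmax : EReal) (x : ℝ → Vec n) : Prop :=
  IsSolution Δ (fun φ (_ : Vec 0) => f₀ φ) (fun _ => 0) x₀ tmax x

/-- Maximal solution of the input-free system `ẋ(t) = f₀(x_t)`. -/
def IsMaxSolution₀ (Δ : ℝ≥0) {n : ℕ} (f₀ : Hist Δ n → Vec n) (x₀ : Hist Δ n)
    (tmax : EReal) (x : ℝ → Vec n) : Prop :=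
  IsMaxSolution Δ (fun φ (_ : Vec 0) => f₀ φ) (fun _ => 0) x₀ tmax x

/-! ### Stability properties (input-free systems) -/

/-- Global asymptotic stability (GAS). -/
def GAS (Δ : ℝ≥0) {n : ℕ} (f₀ : Hist Δ n → Vec n) : Prop :=
  ∃ β : ℝ → ℝ → ℝ, ClassKL β ∧
    ∀ (x₀ : Hist Δ n) (tmax : EReal) (x : ℝ → Vec n),
      IsMaxSolution₀ Δ f₀ x₀ tmax x →
        tmax = ⊤ ∧ ∀ t : ℝ, 0 ≤ t → ‖x t‖ ≤ β ‖x₀‖ t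

/-- Global exponential stability (GES). -/
def GES (Δ : ℝ≥0) {n : ℕ} (f₀ : Hist Δ n → Vec n) : Prop :=
  ∃ k : ℝ, 1 ≤ k ∧ ∃ lam : ℝ, 0 < lam ∧
    ∀ (x₀ : Hist Δ n) (tmax : EReal) (x : ℝ → Vec n),
      IsMaxSolution₀ Δ f₀ x₀ tmax x →
        tmax = ⊤ ∧ ∀ t : ℝ, 0 ≤ t → ‖x t‖ ≤ k * ‖x₀‖ * Real.exp (-lam * t)

/-- (Local) asymptotic stability (AS) of the origin. -/
def AS (Δ : ℝ≥0) {n : ℕ} (f₀ : Hist Δ n → Vec n) : Prop :=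
  ∃ r : ℝ, 0 < r ∧ ∃ β : ℝ → ℝ → ℝ, ClassKL β ∧
    ∀ (x₀ : Hist Δ n) (tmax : EReal) (x : ℝ → Vec n),
      IsMaxSolution₀ Δ f₀ x₀ tmax x → ‖x₀‖ ≤ r →
        tmax = ⊤ ∧ ∀ t : ℝ, 0 ≤ t → ‖x t‖ ≤ β ‖x₀‖ t

/-- (Local) exponential stability (ES) of the origin. -/
def ES (Δ : ℝ≥0) {n : ℕ} (f₀ : Hist Δ n → Vec n) : Prop :=
  ∃ r : ℝ, 0 < r ∧ ∃ k : ℝ, 1 ≤ k ∧ ∃ lam : ℝ, 0 < lam ∧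
    ∀ (x₀ : Hist Δ n) (tmax : EReal) (x : ℝ → Vec n),
      IsMaxSolution₀ Δ f₀ x₀ tmax x → ‖x₀‖ ≤ r →
        tmax = ⊤ ∧ ∀ t : ℝ, 0 ≤ t → ‖x t‖ ≤ k * ‖x₀‖ * Real.exp (-lam * t)

/-! ### Forward completeness -/

/-- Robust forward completeness (RFC) of `ẋ(t) = f(x_t,u(t))`. -/
def RFC (Δ : ℝ≥0) {n m : ℕ} (f : Hist Δ n → Vec m → Vec n) : Prop :=
  (∀ (x₀ : Hist Δ n) (u : ℝ → Vec m) (tmax : EReal) (x : ℝ → Vec n),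
      IsInput u → IsMaxSolution Δ f u x₀ tmax x → tmax = ⊤) ∧
    ∀ T : ℝ, 0 < T → ∀ r : ℝ, 0 < r → ∃ C : ℝ,
      ∀ (x₀ : Hist Δ n) (u : ℝ → Vec m) (tmax : EReal) (x : ℝ → Vec n),
        IsInput u → IsMaxSolution Δ f u x₀ tmax x →
          ‖x₀‖ ≤ r → essBnd u (Ici 0) ≤ r →
            ∀ t : ℝ, t ∈ Icc (0 : ℝ) T → ‖seg Δ x t‖ ≤ C

/-- Robust forward completeness of the input-free system `ẋ(t) = f₀(x_t)`. -/
def RFC₀ (Δ : ℝ≥0) {n : ℕ} (f₀ : Hist Δ n → Vec n) : Prop :=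
  RFC Δ (fun φ (_ : Vec 0) => f₀ φ)

/-! ### Input-to-state stability notions -/

/-- Input-to-state stability (ISS). -/
def ISS (Δ : ℝ≥0) {n m : ℕ} (f : Hist Δ n → Vec m → Vec n) : Prop :=
  ∃ β : ℝ → ℝ → ℝ, ∃ μ : ℝ → ℝ, ClassKL β ∧ ClassN μ ∧
    ∀ (x₀ : Hist Δ n) (u : ℝ → Vec m) (tmax : EReal) (x : ℝ → Vec n),
      IsInput u → IsMaxSolution Δ f u x₀ tmax x →
        tmax = ⊤ ∧ ∀ t : ℝ, 0 ≤ t → ‖x t‖ ≤ β ‖x₀‖ t + μ (essBnd u (Icc 0 t))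

/-- Local input-to-state stability (LISS). -/
def LISS (Δ : ℝ≥0) {n m : ℕ} (f : Hist Δ n → Vec m → Vec n) : Prop :=
  ∃ r : ℝ, 0 < r ∧ ∃ β : ℝ → ℝ → ℝ, ∃ μ : ℝ → ℝ, ClassKL β ∧ ClassN μ ∧
    ∀ (x₀ : Hist Δ n) (u : ℝ → Vec m) (tmax : EReal) (x : ℝ → Vec n),
      IsInput u → IsMaxSolution Δ f u x₀ tmax x →
        ‖x₀‖ ≤ r → essBnd u (Ici 0) ≤ r →
          tmax = ⊤ ∧ ∀ t : ℝ, 0 ≤ t → ‖x t‖ ≤ β ‖x₀‖ t + μ (essBnd u (Icc 0 t))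

/-- Integral input-to-state stability (iISS). -/
def iISS (Δ : ℝ≥0) {n m : ℕ} (f : Hist Δ n → Vec m → Vec n) : Prop :=
  ∃ β : ℝ → ℝ → ℝ, ∃ η μ : ℝ → ℝ, ClassKL β ∧ ClassN η ∧ ClassN μ ∧
    ∀ (x₀ : Hist Δ n) (u : ℝ → Vec m) (tmax : EReal) (x : ℝ → Vec n),
      IsInput u → IsMaxSolution Δ f u x₀ tmax x →
        tmax = ⊤ ∧ ∀ t : ℝ, 0 ≤ t →
          ‖x t‖ ≤ β ‖x₀‖ t + η (∫ s in (0:ℝ)..t, μ ‖u s‖)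

/-- The UBEBS estimate with offset `c`. -/
def UBEBSwith (Δ : ℝ≥0) {n m : ℕ} (f : Hist Δ n → Vec m → Vec n) (c : ℝ) : Prop :=
  ∃ α ξ ζ : ℝ → ℝ, ClassKinf α ∧ ClassKinf ξ ∧ ClassKinf ζ ∧
    ∀ (x₀ : Hist Δ n) (u : ℝ → Vec m) (tmax : EReal) (x : ℝ → Vec n),
      IsInput u → IsMaxSolution Δ f u x₀ tmax x →
        tmax = ⊤ ∧ ∀ t : ℝ, 0 ≤ t →
          α ‖x t‖ ≤ ξ ‖x₀‖ + (∫ s in (0:ℝ)..t, ζ ‖u s‖) + c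

/-! ### Lyapunov–Krasovskii functionals -/

/-- Lyapunov–Krasovskii functional candidate (LKF). -/
def IsLKF {Δ : ℝ≥0} {n : ℕ} (V : Hist Δ n → ℝ) : Prop :=
  (∀ φ, 0 ≤ V φ) ∧ LipOnBoundedV V ∧
    ∃ α₁ α₂ : ℝ → ℝ, ClassKinf α₁ ∧ ClassKinf α₂ ∧
      ∀ φ : Hist Δ n, α₁ ‖ev0 φ‖ ≤ V φ ∧ V φ ≤ α₂ ‖φ‖

/-- Coercive Lyapunov–Krasovskii functional candidate. -/
def IsCoerciveLKF {Δ : ℝ≥0} {n : ℕ} (V : Hist Δ n → ℝ) : Prop :=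
  (∀ φ, 0 ≤ V φ) ∧ LipOnBoundedV V ∧
    ∃ α₁ α₂ : ℝ → ℝ, ClassKinf α₁ ∧ ClassKinf α₂ ∧
      ∀ φ : Hist Δ n, α₁ ‖φ‖ ≤ V φ ∧ V φ ≤ α₂ ‖φ‖

end

/-! ### History segments of continuous trajectories -/

theorem seg_apply {Δ : ℝ≥0} {n : ℕ} {x : ℝ → Vec n} {t : ℝ}
    (hx : ContinuousOn x (Icc (t - (Δ : ℝ)) t)) (τ : Icc (-(Δ : ℝ)) (0 : ℝ)) :
    seg Δ x t τ = x (t + τ.1) := by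
  rw [seg, dif_pos hx]
  rfl

theorem norm_seg_le {Δ : ℝ≥0} {n : ℕ} {x : ℝ → Vec n} {t C : ℝ} (hC : 0 ≤ C)
    (hx : ContinuousOn x (Icc (t - (Δ : ℝ)) t))
    (h : ∀ s ∈ Icc (t - (Δ : ℝ)) t, ‖x s‖ ≤ C) : ‖seg Δ x t‖ ≤ C := by
  rw [ContinuousMap.norm_le _ hC]
  intro τ
  rw [seg_apply hx]
  exact h _ ⟨by linarith [τ.2.1], by linarith [τ.2.2]⟩

theorem norm_le_norm_seg {Δ : ℝ≥0} {n : ℕ} {x : ℝ → Vec n} {t s : ℝ}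
    (hx : ContinuousOn x (Icc (t - (Δ : ℝ)) t)) (hs : s ∈ Icc (t - (Δ : ℝ)) t) :
    ‖x s‖ ≤ ‖seg Δ x t‖ := by
  have h := (seg Δ x t).norm_coe_le_norm ⟨s - t, by linarith [hs.1], by linarith [hs.2]⟩
  rw [seg_apply hx] at h
  simpa using h

theorem norm_seg_sub_seg_le {Δ : ℝ≥0} {n : ℕ} {x y : ℝ → Vec n} {t C : ℝ} (hC : 0 ≤ C)
    (hx : ContinuousOn x (Icc (t - (Δ : ℝ)) t)) (hy : ContinuousOn y (Icc (t - (Δ : ℝ)) t))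
    (h : ∀ s ∈ Icc (t - (Δ : ℝ)) t, ‖x s - y s‖ ≤ C) : ‖seg Δ x t - seg Δ y t‖ ≤ C := by
  rw [ContinuousMap.norm_le _ hC]
  intro τ
  rw [ContinuousMap.sub_apply, seg_apply hx, seg_apply hy]
  exact h _ ⟨by linarith [τ.2.1], by linarith [τ.2.2]⟩

theorem seg_comp_sub {Δ : ℝ≥0} {n : ℕ} {x : ℝ → Vec n} (hx : Continuous x) (a t : ℝ) :
    seg Δ (fun s => x (s - a)) t = seg Δ x (t - a) := by
  ext1 τ
  have hx' : Continuous fun s => x (s - a) := by fun_prop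
  rw [seg_apply hx'.continuousOn, seg_apply hx.continuousOn]
  congr 1
  ring

theorem seg_zero_of_init {Δ : ℝ≥0} {n : ℕ} {x : ℝ → Vec n} {x₀ : Hist Δ n}
    (hx : ContinuousOn x (Icc (-(Δ : ℝ)) 0))
    (h : ∀ τ : Icc (-(Δ : ℝ)) (0 : ℝ), x τ.1 = x₀ τ) : seg Δ x 0 = x₀ := by
  ext1 τ
  rw [seg_apply (by simpa using hx), zero_add, h]

theorem continuous_seg {Δ : ℝ≥0} {n : ℕ} {x : ℝ → Vec n} (hx : Continuous x) :
    Continuous (seg Δ x) := by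
  let F : C(ℝ × Icc (-(Δ : ℝ)) (0 : ℝ), Vec n) :=
    ⟨fun q => x (q.1 + q.2.1), by fun_prop⟩
  have hF : seg Δ x = F.curry := by
    funext t
    ext1 τ
    rw [seg_apply hx.continuousOn]
    rfl
  rw [hF]
  exact F.curry.continuous

/-! ### Comparison of trajectories -/

theorem norm_integral_le_of_norm_le_exp {n : ℕ} {F : ℝ → Vec n} {a t α A C : ℝ} (hat : a ≤ t)
    (hα : 0 < α) (hA : 0 ≤ A)
    (hF : ∀ᵐ s ∂volume, s ∈ Icc a t → ‖F s‖ ≤ A * Real.exp (α * (s - a)) + C) :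
    ‖∫ s in a..t, F s‖ ≤ A / α * Real.exp (α * (t - a)) + C * (t - a) := by
  have hderiv : ∀ s ∈ uIcc a t, HasDerivAt
      (fun s => A / α * Real.exp (α * (s - a)) + C * (s - a))
      (A * Real.exp (α * (s - a)) + C) s := by
    intro s _
    have h1 : HasDerivAt (fun s : ℝ => s - a) 1 s := (hasDerivAt_id s).sub_const a
    have h2 := (((h1.const_mul α).exp).const_mul (A / α)).add (h1.const_mul C)
    refine h2.congr_deriv ?_
    field_simp
  have hcont : Continuous fun s => A * Real.exp (α * (s - a)) + C := by fun_prop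
  have hint := intervalIntegral.integral_eq_sub_of_hasDerivAt hderiv
    (hcont.intervalIntegrable a t)
  have hle := intervalIntegral.norm_integral_le_of_norm_le hat
    (g := fun s => A * Real.exp (α * (s - a)) + C) (f := F) (μ := volume)
    (by filter_upwards [hF] with s hs hs' using hs (Ioc_subset_Icc_self hs'))
    (hcont.intervalIntegrable a t)
  rw [hint] at hle
  have : 0 ≤ A / α := by positivity
  simp only [sub_self, mul_zero, Real.exp_zero, mul_one] at hle
  linarith

/-- A Grönwall-type estimate, through an exponentially weighted sup norm. -/
theorem norm_sub_le_of_norm_rhs_sub_le {Δ : ℝ≥0} {n : ℕ} {x y F G : ℝ → Vec n} {a b K C : ℝ}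
    (hab : a ≤ b) (hK : 0 < K) (hC : 0 ≤ C)
    (hx : ContinuousOn x (Icc (a - (Δ : ℝ)) b)) (hy : ContinuousOn y (Icc (a - (Δ : ℝ)) b))
    (hxy : ∀ s ∈ Icc (a - (Δ : ℝ)) a, x s = y s)
    (hFi : IntervalIntegrable F volume a b) (hGi : IntervalIntegrable G volume a b)
    (hxF : ∀ t ∈ Icc a b, x t = x a + ∫ s in a..t, F s)
    (hyG : ∀ t ∈ Icc a b, y t = y a + ∫ s in a..t, G s)
    (hFG : ∀ᵐ s ∂volume, s ∈ Icc a b → ‖F s - G s‖ ≤ K * ‖seg Δ x s - seg Δ y s‖ + C) :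
    ∀ t ∈ Icc a b, ‖x t - y t‖ ≤ 2 * (C * (b - a)) * Real.exp (2 * K * (t - a)) := by
  have hΔ : (0 : ℝ) ≤ Δ := Δ.coe_nonneg
  have hsub : Icc a b ⊆ Icc (a - (Δ : ℝ)) b := Icc_subset_Icc_left (by linarith)
  obtain ⟨c, hc, hmax⟩ := isCompact_Icc.exists_isMaxOn (nonempty_Icc.2 hab)
    (f := fun t => ‖x t - y t‖ * Real.exp (-(2 * K * (t - a))))
    (((hx.mono hsub).sub (hy.mono hsub)).norm.mul (by fun_prop))
  set W := ‖x c - y c‖ * Real.exp (-(2 * K * (c - a))) with hW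
  have hW0 : 0 ≤ W := by positivity
  have hbound : ∀ t ∈ Icc a b, ‖x t - y t‖ ≤ W * Real.exp (2 * K * (t - a)) := by
    intro t ht
    have h : ‖x t - y t‖ * Real.exp (-(2 * K * (t - a))) ≤ W := hmax ht
    rwa [Real.exp_neg, ← div_eq_mul_inv, div_le_iff₀ (Real.exp_pos _)] at h
  have hseg : ∀ s ∈ Icc a b, ‖seg Δ x s - seg Δ y s‖ ≤ W * Real.exp (2 * K * (s - a)) := by
    intro s hs
    have hss : Icc (s - (Δ : ℝ)) s ⊆ Icc (a - (Δ : ℝ)) b :=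
      Icc_subset_Icc (by linarith [hs.1]) hs.2
    refine norm_seg_sub_seg_le (by positivity) (hx.mono hss) (hy.mono hss) fun r hr => ?_
    rcases le_total r a with hra | hra
    · rw [hxy r ⟨(hss hr).1, hra⟩, sub_self, norm_zero]
      positivity
    · refine (hbound r ⟨hra, (hss hr).2⟩).trans ?_
      have := hr.2
      gcongr
  have hdiff : ∀ t ∈ Icc a b,
      ‖x t - y t‖ ≤ W / 2 * Real.exp (2 * K * (t - a)) + C * (b - a) := by
    intro t ht
    have hs : uIcc a t ⊆ uIcc a b := by
      rw [uIcc_of_le ht.1, uIcc_of_le hab]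
      exact Icc_subset_Icc_right ht.2
    have heq : x t - y t = ∫ s in a..t, (F s - G s) := by
      rw [intervalIntegral.integral_sub (hFi.mono_set hs) (hGi.mono_set hs), hxF t ht, hyG t ht,
        hxy a ⟨by linarith, le_rfl⟩]
      abel
    have h := norm_integral_le_of_norm_le_exp (F := fun s => F s - G s) (A := K * W)
      (α := 2 * K) (C := C) ht.1 (by positivity) (by positivity) (by
        filter_upwards [hFG] with s hs hst
        have hs' : s ∈ Icc a b := ⟨hst.1, hst.2.trans ht.2⟩
        refine (hs hs').trans ?_
        rw [mul_assoc]
        have := hseg s hs'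
        gcongr)
    rw [← heq] at h
    have h2 : K * W / (2 * K) = W / 2 := by field_simp
    rw [h2] at h
    have := mul_le_mul_of_nonneg_left (sub_le_sub_right ht.2 a) hC
    linarith
  have hWle : W ≤ 2 * (C * (b - a)) := by
    have h := hdiff c hc
    have hcb : 0 ≤ C * (b - a) := mul_nonneg hC (by linarith)
    have he : 1 ≤ Real.exp (2 * K * (c - a)) :=
      Real.one_le_exp (mul_nonneg (by positivity) (by linarith [hc.1]))
    have h3 : ‖x c - y c‖ = W * Real.exp (2 * K * (c - a)) := by
      rw [hW, mul_assoc, ← Real.exp_add]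
      simp
    rw [h3] at h
    nlinarith
  intro t ht
  exact (hbound t ht).trans (by gcongr)

/-! ### Global existence for globally Lipschitz systems -/

theorem intervalIntegrable_of_linear_growth {Δ : ℝ≥0} {n : ℕ} {g : ℝ → Hist Δ n → Vec n}
    {K B : ℝ} (hg : ∀ s φ, ‖g s φ‖ ≤ K * ‖φ‖ + B)
    (hmeas : ∀ ψ : ℝ → Hist Δ n, Continuous ψ →
      AEStronglyMeasurable (fun s => g s (ψ s)) volume)
    {ψ : ℝ → Hist Δ n} (hψ : Continuous ψ) (a b : ℝ) :
    IntervalIntegrable (fun s => g s (ψ s)) volume a b := by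
  have hc : Continuous fun s => K * ‖ψ s‖ + B := by fun_prop
  exact (hc.intervalIntegrable a b).mono_fun' (hmeas ψ hψ).restrict
    (Eventually.of_forall fun s => hg s (ψ s))

theorem exists_continuous_forall_eq_integral {Δ : ℝ≥0} {n : ℕ} {g : ℝ → Hist Δ n → Vec n}
    {K B : ℝ} (hK : 0 < K) (hB : 0 ≤ B)
    (hlip : ∀ s φ ψ, ‖g s φ - g s ψ‖ ≤ K * ‖φ - ψ‖) (hg : ∀ s φ, ‖g s φ‖ ≤ K * ‖φ‖ + B)
    (hmeas : ∀ ψ : ℝ → Hist Δ n, Continuous ψ →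
      AEStronglyMeasurable (fun s => g s (ψ s)) volume)
    (x₀ : Hist Δ n) :
    ∃ x : ℝ → Vec n, Continuous x ∧ (∀ τ : Icc (-(Δ : ℝ)) (0 : ℝ), x τ.1 = x₀ τ) ∧
      ∀ t : ℝ, 0 ≤ t → x t = x 0 + ∫ s in (0 : ℝ)..t, g s (seg Δ x s) := by
  have hΔ : -(Δ : ℝ) ≤ 0 := neg_nonpos.mpr Δ.coe_nonneg
  set α := 2 * K with hα
  have hα0 : 0 < α := by positivity
  let X : BoundedContinuousFunction ℝ (Vec n) → ℝ → Vec n :=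
    fun w t => Real.exp (α * max t 0) • w t
  have hXc : ∀ w, Continuous (X w) := fun w =>
    (by fun_prop : Continuous fun t : ℝ => Real.exp (α * max t 0)).smul w.continuous
  have hXseg : ∀ w s, 0 ≤ s → ‖seg Δ (X w) s‖ ≤ ‖w‖ * Real.exp (α * s) := by
    intro w s hs
    refine norm_seg_le (by positivity) (hXc w).continuousOn fun r hr => ?_
    rw [norm_smul, Real.norm_eq_abs, Real.abs_exp, mul_comm]
    have := w.norm_coe_le_norm r
    have : max r 0 ≤ s := max_le hr.2 hs
    gcongr
  have hXseg' : ∀ w w' s, 0 ≤ s →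
      ‖seg Δ (X w) s - seg Δ (X w') s‖ ≤ dist w w' * Real.exp (α * s) := by
    intro w w' s hs
    refine norm_seg_sub_seg_le (by positivity) (hXc w).continuousOn (hXc w').continuousOn
      fun r hr => ?_
    rw [← smul_sub, norm_smul, Real.norm_eq_abs, Real.abs_exp, mul_comm, ← dist_eq_norm]
    have := BoundedContinuousFunction.dist_coe_le_dist (f := w) (g := w') r
    have : max r 0 ≤ s := max_le hr.2 hs
    gcongr
  have hint : ∀ w a b, IntervalIntegrable (fun s => g s (seg Δ (X w) s)) volume a b :=
    fun w a b => intervalIntegrable_of_linear_growth hg hmeas (continuous_seg (hXc w)) a b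
  let I : BoundedContinuousFunction ℝ (Vec n) → ℝ → Vec n :=
    fun w t => ∫ s in (0 : ℝ)..max t 0, g s (seg Δ (X w) s)
  have hIc : ∀ w, Continuous (I w) := fun w =>
    (intervalIntegral.continuous_primitive (hint w) 0).comp (by fun_prop : Continuous
      fun t : ℝ => max t 0)
  have hI : ∀ w t, ‖I w t‖ ≤ (K * ‖w‖ + B) / α * Real.exp (α * max t 0) := by
    intro w t
    have h := norm_integral_le_of_norm_le_exp (F := fun s => g s (seg Δ (X w) s))
      (le_max_right t 0) hα0 (A := K * ‖w‖ + B) (C := 0) (by positivity)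
      (Eventually.of_forall fun s hs => by
        refine (hg s _).trans ?_
        have h1 := mul_le_mul_of_nonneg_left (hXseg w s hs.1) hK.le
        have h2 : 1 ≤ Real.exp (α * s) := Real.one_le_exp (mul_nonneg hα0.le hs.1)
        rw [sub_zero]
        nlinarith)
    simpa using h
  have hI' : ∀ w w' t, ‖I w t - I w' t‖ ≤ dist w w' / 2 * Real.exp (α * max t 0) := by
    intro w w' t
    have h := norm_integral_le_of_norm_le_exp
      (F := fun s => g s (seg Δ (X w) s) - g s (seg Δ (X w') s))
      (le_max_right t 0) hα0 (A := K * dist w w') (C := 0) (by positivity)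
      (Eventually.of_forall fun s hs => by
        refine (hlip s _ _).trans ?_
        rw [sub_zero, add_zero, mul_assoc]
        exact mul_le_mul_of_nonneg_left (hXseg' w w' s hs.1) hK.le)
    rw [intervalIntegral.integral_sub (hint w _ _) (hint w' _ _)] at h
    have h2 : K * dist w w' / α = dist w w' / 2 := by
      rw [hα]
      field_simp
    simpa [h2] using h
  let p₀ : ℝ → Vec n := fun t => x₀ (projIcc (-(Δ : ℝ)) 0 hΔ t)
  have hp₀ : Continuous p₀ := x₀.continuous.comp continuous_projIcc
  let Φ : BoundedContinuousFunction ℝ (Vec n) → BoundedContinuousFunction ℝ (Vec n) :=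
    fun w => BoundedContinuousFunction.ofNormedAddCommGroup
      (fun t => Real.exp (-(α * max t 0)) • (p₀ t + I w t))
      ((by fun_prop : Continuous fun t : ℝ => Real.exp (-(α * max t 0))).smul
        (hp₀.add (hIc w)))
      (‖x₀‖ + (K * ‖w‖ + B) / α) (by
        intro t
        rw [norm_smul, Real.norm_eq_abs, Real.abs_exp, Real.exp_neg,
          inv_mul_le_iff₀ (by positivity)]
        have h1 : 1 ≤ Real.exp (α * max t 0) :=
          Real.one_le_exp (mul_nonneg hα0.le (le_max_right t 0))
        have h2 : ‖p₀ t‖ ≤ ‖x₀‖ := x₀.norm_coe_le_norm _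
        have h3 := norm_add_le (p₀ t) (I w t)
        have h4 := hI w t
        nlinarith [norm_nonneg x₀])
  have hΦ : ContractingWith (1 / 2 : ℝ≥0) Φ := by
    refine ⟨by rw [← NNReal.coe_lt_coe]; norm_num, LipschitzWith.of_dist_le_mul fun w w' => ?_⟩
    rw [BoundedContinuousFunction.dist_le (by positivity)]
    intro t
    have h : Φ w t - Φ w' t = Real.exp (-(α * max t 0)) • (I w t - I w' t) := by
      change Real.exp (-(α * max t 0)) • (p₀ t + I w t) -
        Real.exp (-(α * max t 0)) • (p₀ t + I w' t) = _
      rw [← smul_sub]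
      congr 1
      abel
    rw [dist_eq_norm, h, norm_smul, Real.norm_eq_abs, Real.abs_exp, Real.exp_neg,
      inv_mul_le_iff₀ (by positivity)]
    refine (hI' w w' t).trans (le_of_eq ?_)
    push_cast
    ring
  obtain ⟨w, hw⟩ : ∃ w, Φ w = w := ⟨_, hΦ.fixedPoint_isFixedPt⟩
  have hX : ∀ t, X w t = p₀ t + I w t := by
    intro t
    have h : w t = Real.exp (-(α * max t 0)) • (p₀ t + I w t) := by
      conv_lhs => rw [← hw]
      rfl
    change Real.exp (α * max t 0) • w t = _
    rw [h, smul_smul, ← Real.exp_add, add_neg_cancel, Real.exp_zero, one_smul]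
  have hinit : ∀ τ : Icc (-(Δ : ℝ)) (0 : ℝ), X w τ.1 = x₀ τ := by
    intro τ
    rw [hX]
    have h1 : I w τ.1 = 0 := by
      change ∫ s in (0 : ℝ)..max τ.1 0, g s (seg Δ (X w) s) = 0
      rw [max_eq_right τ.2.2, intervalIntegral.integral_same]
    rw [h1, add_zero]
    change x₀ (projIcc _ _ hΔ τ.1) = _
    rw [projIcc_val]
  refine ⟨X w, hXc w, hinit, fun t ht => ?_⟩
  rw [hinit ⟨0, zero_mem_IccD Δ⟩, hX t]
  congr 1
  · change x₀ (projIcc _ _ hΔ t) = _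
    rw [projIcc_of_right_le hΔ ht]
  · change ∫ s in (0 : ℝ)..max t 0, g s (seg Δ (X w) s) = _
    rw [max_eq_left ht]

/-! ### Continuation of bounded solutions -/

theorem exists_lipschitz_retraction_closedBall {E : Type*} [NormedAddCommGroup E]
    [NormedSpace ℝ E] {r : ℝ} (hr : 0 < r) :
    ∃ P : E → E, (∀ φ, ‖P φ‖ ≤ r) ∧ (∀ φ, ‖φ‖ ≤ r → P φ = φ) ∧
      ∀ φ ψ, ‖P φ - P ψ‖ ≤ 2 * ‖φ - ψ‖ := by
  have hpos : ∀ φ : E, 0 < max r ‖φ‖ := fun φ => lt_max_of_lt_left hr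
  refine ⟨fun φ => (r / max r ‖φ‖) • φ, fun φ => ?_, fun φ hφ => ?_, fun φ ψ => ?_⟩
  · rw [norm_smul, Real.norm_of_nonneg (div_nonneg hr.le (hpos φ).le), div_mul_eq_mul_div,
      div_le_iff₀ (hpos φ)]
    exact mul_le_mul_of_nonneg_left (le_max_right _ _) hr.le
  · simp only [max_eq_left hφ, div_self hr.ne', one_smul]
  · have heq : (r / max r ‖φ‖) • φ - (r / max r ‖ψ‖) • ψ =
        (r / max r ‖φ‖) • (φ - ψ) + (r / max r ‖φ‖ - r / max r ‖ψ‖) • ψ := by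
      rw [smul_sub, sub_smul]
      abel
    have ha : r / max r ‖φ‖ ≤ 1 := (div_le_one (hpos φ)).2 (le_max_left _ _)
    have hab : |r / max r ‖φ‖ - r / max r ‖ψ‖| * ‖ψ‖ ≤ ‖φ - ψ‖ := by
      have h1 : r / max r ‖φ‖ - r / max r ‖ψ‖ =
          (r / max r ‖φ‖) * ((max r ‖ψ‖ - max r ‖φ‖) / max r ‖ψ‖) := by
        have := (hpos φ).ne'
        have := (hpos ψ).ne'
        field_simp
      have h2 : |max r ‖ψ‖ - max r ‖φ‖| ≤ ‖φ - ψ‖ := by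
        rw [max_comm r, max_comm r]
        refine (abs_max_sub_max_le_abs _ _ _).trans ?_
        rw [norm_sub_rev]
        exact abs_norm_sub_norm_le _ _
      have h3 : ‖ψ‖ / max r ‖ψ‖ ≤ 1 := (div_le_one (hpos ψ)).2 (le_max_right _ _)
      rw [h1, abs_mul, abs_of_nonneg (div_nonneg hr.le (hpos φ).le), abs_div,
        abs_of_pos (hpos ψ)]
      calc r / max r ‖φ‖ * (|max r ‖ψ‖ - max r ‖φ‖| / max r ‖ψ‖) * ‖ψ‖
          = r / max r ‖φ‖ * (|max r ‖ψ‖ - max r ‖φ‖| * (‖ψ‖ / max r ‖ψ‖)) := by ring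
        _ ≤ 1 * (‖φ - ψ‖ * 1) := by
            have := hpos ψ
            gcongr
        _ = ‖φ - ψ‖ := by ring
    change ‖(r / max r ‖φ‖) • φ - (r / max r ‖ψ‖) • ψ‖ ≤ _
    rw [heq]
    refine (norm_add_le _ _).trans ?_
    rw [norm_smul, norm_smul, Real.norm_of_nonneg (div_nonneg hr.le (hpos φ).le),
      Real.norm_eq_abs]
    have := mul_le_mul_of_nonneg_right ha (norm_nonneg (φ - ψ))
    linarith

theorem LipOnBounded.continuous {Δ : ℝ≥0} {n m : ℕ} {f : Hist Δ n → Vec m → Vec n}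
    (hf : LipOnBounded f) : Continuous fun q : Hist Δ n × Vec m => f q.1 q.2 := by
  rw [continuous_iff_continuousAt]
  intro q
  obtain ⟨K, -, hK⟩ := hf (max ‖q.1‖ ‖q.2‖ + 1) (by positivity)
  have hq1 : ‖q.1‖ < max ‖q.1‖ ‖q.2‖ + 1 := by linarith [le_max_left ‖q.1‖ ‖q.2‖]
  have hq2 : ‖q.2‖ < max ‖q.1‖ ‖q.2‖ + 1 := by linarith [le_max_right ‖q.1‖ ‖q.2‖]
  rw [ContinuousAt, tendsto_iff_norm_sub_tendsto_zero]
  have hlim : Tendsto (fun z : Hist Δ n × Vec m => K * (‖z.1 - q.1‖ + ‖z.2 - q.2‖)) (𝓝 q)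
      (𝓝 0) := by
    have hc : Continuous fun z : Hist Δ n × Vec m => K * (‖z.1 - q.1‖ + ‖z.2 - q.2‖) := by
      fun_prop
    simpa using hc.tendsto q
  refine squeeze_zero' (Eventually.of_forall fun _ => norm_nonneg _) ?_ hlim
  filter_upwards [continuous_fst.norm.continuousAt.eventually_lt_const hq1,
    continuous_snd.norm.continuousAt.eventually_lt_const hq2] with z hz1 hz2
  exact hK _ _ _ _ hz1.le hq1.le hz2.le hq2.le

theorem IsMaxSolution.eq_top_of_bounded {Δ : ℝ≥0} {n m : ℕ} {f : Hist Δ n → Vec m → Vec n}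
    {u : ℝ → Vec m} {x₀ : Hist Δ n} {tmax : EReal} {x : ℝ → Vec n} {R : ℝ}
    (hx : IsMaxSolution Δ f u x₀ tmax x) (hf : LipOnBounded f) (hu : IsInput u)
    (hR : ∀ t : ℝ, -(Δ : ℝ) ≤ t → (t : EReal) < tmax → ‖x t‖ ≤ R) : tmax = ⊤ := by
  have hΔ : (0 : ℝ) ≤ Δ := Δ.coe_nonneg
  obtain ⟨hsol, hmax⟩ := hx
  have hR0 : 0 ≤ R := (norm_nonneg _).trans (hR 0 (by linarith) hsol.tmax_pos)
  induction tmax using EReal.rec with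
  | bot => exact absurd hsol.tmax_pos (by simp)
  | top => rfl
  | coe b =>
  exfalso
  have hb : 0 < b := by simpa using hsol.tmax_pos
  obtain ⟨C, hC⟩ := hu.2 (b + 1) (by linarith)
  set r := max (R + 1) C with hr
  have hr0 : 0 < r := lt_max_of_lt_left (by linarith)
  obtain ⟨K, hK0, hK⟩ := hf r hr0
  obtain ⟨P, hP1, hP2, hP3⟩ := exists_lipschitz_retraction_closedBall (E := Hist Δ n) hr0
  classical
  let v : ℝ → Vec m := fun s => if s ∈ Icc 0 (b + 1) ∧ ‖u s‖ ≤ C then u s else 0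
  have hvm : Measurable v := Measurable.ite
    (measurableSet_Icc.inter (measurableSet_le hu.1.norm measurable_const)) hu.1
    measurable_const
  have hvr : ∀ s, ‖v s‖ ≤ r := by
    intro s
    by_cases h : s ∈ Icc 0 (b + 1) ∧ ‖u s‖ ≤ C
    · simp only [v, if_pos h]
      exact h.2.trans (le_max_right _ _)
    · simp only [v, if_neg h, norm_zero]
      exact hr0.le
  have hvu : ∀ᵐ s ∂volume, s ∈ Icc (0 : ℝ) (b + 1) → v s = u s := by
    filter_upwards [hC] with s hs hs'
    exact if_pos ⟨hs', hs hs'⟩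
  let g : ℝ → Hist Δ n → Vec n := fun s φ => f (P φ) (v s)
  have hlip : ∀ s φ ψ, ‖g s φ - g s ψ‖ ≤ 2 * K * ‖φ - ψ‖ := by
    intro s φ ψ
    have h := hK (P φ) (P ψ) (v s) (v s) (hP1 _) (hP1 _) (hvr s) (hvr s)
    rw [sub_self, norm_zero, add_zero] at h
    have := mul_le_mul_of_nonneg_left (hP3 φ ψ) hK0.le
    linarith
  have hgrow : ∀ s φ, ‖g s φ‖ ≤ 2 * K * ‖φ‖ + (K * (r + r) + ‖f 0 0‖) := by
    intro s φ
    have h := hK (P φ) 0 (v s) 0 (hP1 _) (by simpa using hr0.le) (hvr s) (by simpa using hr0.le)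
    rw [sub_zero, sub_zero] at h
    have h2 := mul_le_mul_of_nonneg_left (add_le_add (hP1 φ) (hvr s)) hK0.le
    have h3 : ‖g s φ‖ ≤ ‖f (P φ) (v s) - f 0 0‖ + ‖f 0 0‖ := by
      simpa using norm_add_le (f (P φ) (v s) - f 0 0) (f 0 0)
    have h4 : 0 ≤ 2 * K * ‖φ‖ := by positivity
    linarith
  have hPc : Continuous P := by
    refine (LipschitzWith.of_dist_le_mul (K := 2) fun φ ψ => ?_).continuous
    simpa [dist_eq_norm] using hP3 φ ψ
  have hmeas : ∀ ψ : ℝ → Hist Δ n, Continuous ψ →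
      AEStronglyMeasurable (fun s => g s (ψ s)) volume := by
    intro ψ hψ
    exact hf.continuous.comp_aestronglyMeasurable
      (((hPc.comp hψ).aestronglyMeasurable).prodMk hvm.aestronglyMeasurable)
  obtain ⟨z, hzc, hz0, hz⟩ := exists_continuous_forall_eq_integral (by positivity)
    (by positivity) hlip hgrow hmeas x₀
  have hgi := fun c d =>
    intervalIntegrable_of_linear_growth hgrow hmeas (continuous_seg hzc) c d
  have hzx0 : ∀ s ∈ Icc (-(Δ : ℝ)) 0, x s = z s := fun s hs =>
    (hsol.init ⟨s, hs⟩).trans (hz0 ⟨s, hs⟩).symm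
  have hzx : ∀ t, 0 ≤ t → t < b → x t = z t := by
    intro t ht0 htb
    have hcont : ContinuousOn x (Icc (-(Δ : ℝ)) t) := hsol.cont.mono fun s hs =>
      ⟨hs.1, EReal.coe_lt_coe_iff.2 (hs.2.trans_lt htb)⟩
    have h := norm_sub_le_of_norm_rhs_sub_le (Δ := Δ) (x := x) (y := z) (a := 0) (b := t)
      (F := fun s => f (seg Δ x s) (u s)) (G := fun s => g s (seg Δ z s)) (K := 2 * K) (C := 0)
      ht0 (by positivity) le_rfl (by simpa using hcont) hzc.continuousOn (by simpa using hzx0)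
      (hsol.integrable t ht0 (EReal.coe_lt_coe_iff.2 htb)) (hgi _ _)
      (fun s hs => hsol.integral_eq s hs.1 (EReal.coe_lt_coe_iff.2 (hs.2.trans_lt htb)))
      (fun s hs => hz s hs.1) (by
        filter_upwards [hvu] with s hs hst
        have hsx : ‖seg Δ x s‖ ≤ r := by
          refine (norm_seg_le hR0 (hcont.mono (Icc_subset_Icc (by linarith [hst.1]) hst.2))
            fun q hq => hR q (by linarith [hq.1, hst.1]) (EReal.coe_lt_coe_iff.2 ?_)).trans
            (by linarith [le_max_left (R + 1) C])
          linarith [hq.2, hst.2]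
        have : f (seg Δ x s) (u s) = g s (seg Δ x s) := by
          simp only [g, hP2 _ hsx, hs ⟨hst.1, by linarith [hst.2]⟩]
        rw [this, add_zero]
        exact hlip _ _ _) t ⟨ht0, le_rfl⟩
    simpa [sub_eq_zero] using h
  have hzR : ∀ t, -(Δ : ℝ) ≤ t → t < b → ‖z t‖ ≤ R := by
    intro t ht htb
    have : x t = z t := by
      rcases le_total t 0 with h | h
      · exact hzx0 t ⟨ht, h⟩
      · exact hzx t h htb
    rw [← this]
    exact hR t ht (EReal.coe_lt_coe_iff.2 htb)
  have hzb : ‖z b‖ ≤ R := by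
    refine le_of_tendsto (hzc.norm.continuousAt.tendsto.mono_left
      (nhdsWithin_le_nhds (s := Iio b))) ?_
    filter_upwards [Ioo_mem_nhdsLT hb] with t ht
    exact hzR t (by linarith [ht.1]) ht.2
  obtain ⟨δ, hδ, hδz⟩ := Metric.eventually_nhds_iff.1
    (hzc.norm.continuousAt.eventually_lt_const (hzb.trans_lt (lt_add_one R)))
  set ε := min δ 1 with hε
  have hε0 : 0 < ε := lt_min hδ one_pos
  have hzr : ∀ t, -(Δ : ℝ) ≤ t → t < b + ε → ‖z t‖ ≤ r := by
    intro t ht htb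
    have hle := le_max_left (R + 1) C
    rcases lt_or_ge t b with h | h
    · linarith [hzR t ht h]
    · have := hδz (y := t) (by
        rw [Real.dist_eq, abs_of_nonneg (by linarith)]
        linarith [min_le_left δ 1])
      linarith
  have hcongr : ∀ t : ℝ, 0 ≤ t → t < b + ε → ∀ᵐ s ∂volume, s ∈ uIoc 0 t →
      g s (seg Δ z s) = f (seg Δ z s) (u s) := by
    intro t ht0 htb
    filter_upwards [hvu] with s hs hst
    rw [uIoc_of_le ht0] at hst
    have hsz : ‖seg Δ z s‖ ≤ r := norm_seg_le hr0.le hzc.continuousOn fun q hq =>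
      hzr q (by linarith [hq.1, hst.1]) (by linarith [hq.2, hst.2])
    simp only [g, hP2 _ hsz, hs ⟨hst.1.le, by linarith [hst.2, min_le_right δ 1]⟩]
  have hsolz : IsSolution Δ f u x₀ ((b + ε : ℝ) : EReal) z :=
    { tmax_pos := by exact_mod_cast (by linarith : 0 < b + ε)
      cont := hzc.continuousOn
      init := hz0
      integrable := fun t ht0 htb => (hgi 0 t).congr_ae
        ((ae_restrict_iff' measurableSet_uIoc).2
          (hcongr t ht0 (EReal.coe_lt_coe_iff.1 htb)))
      integral_eq := fun t ht0 htb => by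
        rw [hz t ht0, intervalIntegral.integral_congr_ae
          (hcongr t ht0 (EReal.coe_lt_coe_iff.1 htb))] }
  have hle := hmax _ z hsolz (by
    intro t ht htb
    have htb' := EReal.coe_lt_coe_iff.1 htb
    rcases le_total t 0 with h | h
    · exact (hzx0 t ⟨ht, h⟩).symm
    · exact (hzx t h htb').symm)
  have := EReal.coe_le_coe_iff.1 hle
  linarith

/-! ### Perturbation of the input-free system -/

theorem exists_rpow_mul_le_add {p D ε : ℝ} (hp0 : 0 ≤ p) (hp1 : p < 1) (hD : 0 ≤ D)
    (hε0 : 0 < ε) :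
    ∃ C : ℝ, 0 ≤ C ∧ ∀ S M : ℝ, 0 ≤ S → 0 ≤ M →
      S ^ p * (D * M) ≤ ε * S + C * M ^ (1 - p)⁻¹ := by
  have hq : 0 < 1 - p := by linarith
  have hεp : 0 < ε ^ p := Real.rpow_pos_of_pos hε0 p
  refine ⟨(D / ε ^ p) ^ (1 - p)⁻¹, by positivity, fun S M hS hM => ?_⟩
  have hb : 0 ≤ D / ε ^ p * M := by positivity
  have h := Real.geom_mean_le_arith_mean2_weighted (p₁ := ε * S)
    (p₂ := (D / ε ^ p * M) ^ (1 - p)⁻¹) hp0 hq.le (by positivity) (by positivity) (by ring)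
  rw [Real.rpow_inv_rpow hb hq.ne', Real.mul_rpow hε0.le hS] at h
  rw [← Real.mul_rpow (by positivity) hM]
  have h1 : ε ^ p * S ^ p * (D / ε ^ p * M) = S ^ p * (D * M) := by
    field_simp
  rw [h1] at h
  have h2 : 0 ≤ (D / ε ^ p * M) ^ (1 - p)⁻¹ := by positivity
  have h3 : 0 ≤ ε * S := by positivity
  nlinarith

theorem norm_le_of_norm_input_le {Δ : ℝ≥0} {n m : ℕ} {f : Hist Δ n → Vec m → Vec n}
    {L p k lam : ℝ} (hf0 : f 0 0 = 0) (hL : 0 < L) (hp0 : 0 ≤ p)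
    (h1 : ∀ φ ψ : Hist Δ n, ‖f φ 0 - f ψ 0‖ ≤ L * ‖φ - ψ‖)
    (h2 : ∀ (φ : Hist Δ n) (v : Vec m), ‖f φ v - f φ 0‖ ≤ L * max (‖φ‖ ^ p) 1 * ‖v‖)
    (hGES : ∀ (x₀ : Hist Δ n) (tmax : EReal) (x : ℝ → Vec n),
      IsMaxSolution₀ Δ (fun φ => f φ 0) x₀ tmax x →
        tmax = ⊤ ∧ ∀ t : ℝ, 0 ≤ t → ‖x t‖ ≤ k * ‖x₀‖ * Real.exp (-lam * t))
    {x : ℝ → Vec n} {u : ℝ → Vec m} {a b S M : ℝ} (hab : a ≤ b) (hM : 0 ≤ M)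
    (hx : ContinuousOn x (Icc (a - (Δ : ℝ)) b))
    (hxi : IntervalIntegrable (fun s => f (seg Δ x s) (u s)) volume a b)
    (hxF : ∀ t ∈ Icc a b, x t = x a + ∫ s in a..t, f (seg Δ x s) (u s))
    (hu : ∀ᵐ s ∂volume, s ∈ Icc a b → ‖u s‖ ≤ M)
    (hS : ∀ s ∈ Icc (a - (Δ : ℝ)) b, ‖x s‖ ≤ S) :
    ∀ t ∈ Icc a b, ‖x t‖ ≤ k * ‖seg Δ x a‖ * Real.exp (-lam * (t - a)) +
      2 * (L * max (S ^ p) 1 * M * (b - a)) * Real.exp (2 * L * (t - a)) := by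
  have hΔ : (0 : ℝ) ≤ Δ := Δ.coe_nonneg
  have hS0 : 0 ≤ S := (norm_nonneg _).trans (hS a ⟨by linarith, hab⟩)
  have hfc : Continuous fun φ : Hist Δ n => f φ 0 := by
    refine (LipschitzWith.of_dist_le_mul (K := L.toNNReal) fun φ ψ => ?_).continuous
    rw [dist_eq_norm, dist_eq_norm, Real.coe_toNNReal L hL.le]
    exact h1 φ ψ
  obtain ⟨y, hyc, hy0, hy⟩ := exists_continuous_forall_eq_integral
    (g := fun _ φ => f φ 0) (B := 0) hL le_rfl (fun _ => h1)
    (fun _ φ => by simpa [hf0] using h1 φ 0)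
    (fun ψ hψ => (hfc.comp hψ).aestronglyMeasurable) (seg Δ x a)
  have hGc : Continuous fun s => f (seg Δ y s) 0 := hfc.comp (continuous_seg hyc)
  have hybound : ∀ t : ℝ, 0 ≤ t → ‖y t‖ ≤ k * ‖seg Δ x a‖ * Real.exp (-lam * t) := by
    refine (hGES (seg Δ x a) ⊤ y ⟨?_, fun _ _ _ _ => le_top⟩).2
    exact ⟨by simp, hyc.continuousOn, hy0, fun t _ _ => hGc.intervalIntegrable 0 t,
      fun t ht _ => hy t ht⟩
  have hya : Continuous fun s => y (s - a) := by fun_prop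
  have hxa : ContinuousOn x (Icc (a - (Δ : ℝ)) a) := hx.mono (Icc_subset_Icc_right hab)
  have hcmp := norm_sub_le_of_norm_rhs_sub_le (Δ := Δ) (x := x) (y := fun s => y (s - a))
    (F := fun s => f (seg Δ x s) (u s)) (G := fun s => f (seg Δ y (s - a)) 0)
    (C := L * max (S ^ p) 1 * M) hab hL (by positivity) hx hya.continuousOn
    (by
      intro s hs
      have h := hy0 ⟨s - a, by linarith [hs.1], by linarith [hs.2]⟩
      rw [seg_apply hxa] at h
      simpa using h.symm)
    hxi ((hGc.comp (continuous_id.sub continuous_const)).intervalIntegrable a b) hxF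
    (by
      intro t ht
      have h := hy (t - a) (by linarith [ht.1])
      rw [intervalIntegral.integral_comp_sub_right (fun s => f (seg Δ y s) 0) a]
      simpa using h)
    (by
      filter_upwards [hu] with s hs hsab
      rw [seg_comp_sub hyc]
      have hss : Icc (s - (Δ : ℝ)) s ⊆ Icc (a - (Δ : ℝ)) b :=
        Icc_subset_Icc (by linarith [hsab.1]) hsab.2
      have hsS : ‖seg Δ x s‖ ≤ S := norm_seg_le hS0 (hx.mono hss) fun r hr => hS r (hss hr)
      have e1 : ‖f (seg Δ x s) (u s) - f (seg Δ x s) 0‖ ≤ L * max (S ^ p) 1 * M := by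
        refine (h2 _ _).trans ?_
        have := hs hsab
        have := Real.rpow_le_rpow (norm_nonneg _) hsS hp0
        gcongr
      have e2 := h1 (seg Δ x s) (seg Δ y (s - a))
      have e3 := norm_sub_le_norm_sub_add_norm_sub (f (seg Δ x s) (u s)) (f (seg Δ x s) 0)
        (f (seg Δ y (s - a)) 0)
      linarith)
  intro t ht
  have e1 := hcmp t ht
  have e2 := hybound (t - a) (by linarith [ht.1])
  have e3 : ‖x t‖ ≤ ‖y (t - a)‖ + ‖x t - y (t - a)‖ := by
    simpa using norm_add_le (y (t - a)) (x t - y (t - a))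
  linarith

theorem norm_le_of_short_interval {Δ : ℝ≥0} {n m : ℕ} {f : Hist Δ n → Vec m → Vec n}
    {L p k lam T D C : ℝ} (hf0 : f 0 0 = 0) (hL : 0 < L) (hp0 : 0 ≤ p)
    (h1 : ∀ φ ψ : Hist Δ n, ‖f φ 0 - f ψ 0‖ ≤ L * ‖φ - ψ‖)
    (h2 : ∀ (φ : Hist Δ n) (v : Vec m), ‖f φ v - f φ 0‖ ≤ L * max (‖φ‖ ^ p) 1 * ‖v‖)
    (hk : 1 ≤ k) (hlam : 0 < lam)
    (hGES : ∀ (x₀ : Hist Δ n) (tmax : EReal) (x : ℝ → Vec n),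
      IsMaxSolution₀ Δ (fun φ => f φ 0) x₀ tmax x →
        tmax = ⊤ ∧ ∀ t : ℝ, 0 ≤ t → ‖x t‖ ≤ k * ‖x₀‖ * Real.exp (-lam * t))
    (hT : 0 < T) (hD : D = 2 * L * T * Real.exp (2 * L * T)) (hC0 : 0 ≤ C)
    (hC : ∀ S M : ℝ, 0 ≤ S → 0 ≤ M →
      S ^ p * (D * M) ≤ 1 / (8 * k) * S + C * M ^ (1 - p)⁻¹)
    {x : ℝ → Vec n} {u : ℝ → Vec m} {a b M : ℝ} (hab : a ≤ b) (hbT : b - a ≤ T) (hM : 0 ≤ M)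
    (hx : ContinuousOn x (Icc (a - (Δ : ℝ)) b))
    (hxi : IntervalIntegrable (fun s => f (seg Δ x s) (u s)) volume a b)
    (hxF : ∀ t ∈ Icc a b, x t = x a + ∫ s in a..t, f (seg Δ x s) (u s))
    (hu : ∀ᵐ s ∂volume, s ∈ Icc a b → ‖u s‖ ≤ M) :
    ∀ t ∈ Icc a b,
      ‖x t‖ ≤ 2 * k * ‖seg Δ x a‖ + 2 * (C * M ^ (1 - p)⁻¹ + D * M) ∧
      ‖x t‖ ≤ k * ‖seg Δ x a‖ * Real.exp (-lam * (t - a)) + ‖seg Δ x a‖ / 4 +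
        2 * (C * M ^ (1 - p)⁻¹ + D * M) := by
  have hΔ : (0 : ℝ) ≤ Δ := Δ.coe_nonneg
  obtain ⟨c, hc, hmax⟩ := isCompact_Icc.exists_isMaxOn
    (nonempty_Icc.2 (by linarith : a - (Δ : ℝ) ≤ b)) hx.norm
  set S := ‖x c‖ with hSdef
  have hS0 : 0 ≤ S := norm_nonneg _
  have hS : ∀ s ∈ Icc (a - (Δ : ℝ)) b, ‖x s‖ ≤ S := fun s hs => hmax hs
  have hD0 : 0 ≤ D := by
    rw [hD]
    positivity
  set A := ‖seg Δ x a‖ with hA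
  have hA0 : 0 ≤ A := norm_nonneg _
  set γ := C * M ^ (1 - p)⁻¹ + D * M with hγ
  have hγ0 : 0 ≤ γ := by positivity
  set ε := 1 / (8 * k) with hε
  have hε0 : 0 < ε := by positivity
  have hεk : ε * k = 1 / 8 := by
    rw [hε]
    field_simp
  have hpert : ∀ t ∈ Icc a b,
      ‖x t‖ ≤ k * A * Real.exp (-lam * (t - a)) + (ε * S + γ) := by
    intro t ht
    have e1 := norm_le_of_norm_input_le hf0 hL hp0 h1 h2 hGES hab hM hx hxi hxF hu hS t ht
    have e2 : 2 * (L * max (S ^ p) 1 * M * (b - a)) * Real.exp (2 * L * (t - a)) ≤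
        max (S ^ p) 1 * (D * M) := by
      have e3 : t - a ≤ T := by linarith [ht.2]
      have e4 : 0 ≤ b - a := by linarith
      calc 2 * (L * max (S ^ p) 1 * M * (b - a)) * Real.exp (2 * L * (t - a))
          ≤ 2 * (L * max (S ^ p) 1 * M * T) * Real.exp (2 * L * T) := by gcongr
        _ = max (S ^ p) 1 * (D * M) := by
          rw [hD]
          ring
    have e5 : max (S ^ p) 1 ≤ S ^ p + 1 :=
      max_le (by linarith) (by linarith [Real.rpow_nonneg hS0 p])
    have e6 := mul_le_mul_of_nonneg_right e5 (mul_nonneg hD0 hM)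
    have e7 := hC S M hS0 hM
    linarith
  have hkA : A ≤ k * A := le_mul_of_one_le_left hA0 hk
  have hSle : S ≤ k * A + (ε * S + γ) := by
    rcases le_total c a with hca | hca
    · have e1 : S ≤ A := norm_le_norm_seg (hx.mono (Icc_subset_Icc_right hab)) ⟨hc.1, hca⟩
      have e2 : 0 ≤ ε * S := by positivity
      linarith
    · have e1 := hpert c ⟨hca, hc.2⟩
      have e2 : Real.exp (-lam * (c - a)) ≤ 1 := Real.exp_le_one_iff.2 (by nlinarith)
      have e3 := mul_le_mul_of_nonneg_left e2 (mul_nonneg (by linarith : 0 ≤ k) hA0)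
      linarith
  have hε8 : ε ≤ 1 / 8 := by nlinarith
  have hkA0 : 0 ≤ k * A := by linarith
  have hS2 : S ≤ 2 * k * A + 2 * γ := by nlinarith
  intro t ht
  refine ⟨(hS t ⟨by linarith [ht.1], ht.2⟩).trans hS2, (hpert t ht).trans ?_⟩
  have e1 := mul_le_mul_of_nonneg_left hS2 hε0.le
  have e2 : ε * (2 * k * A + 2 * γ) = 2 * (ε * k) * A + 2 * ε * γ := by ring
  rw [e2, hεk] at e1
  nlinarith

/-! ### Input-to-state estimate -/

theorem IsSolution.norm_le {Δ : ℝ≥0} {n m : ℕ} {f : Hist Δ n → Vec m → Vec n}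
    {L p k lam τ T D C : ℝ} (hf0 : f 0 0 = 0) (hL : 0 < L) (hp0 : 0 ≤ p)
    (h1 : ∀ φ ψ : Hist Δ n, ‖f φ 0 - f ψ 0‖ ≤ L * ‖φ - ψ‖)
    (h2 : ∀ (φ : Hist Δ n) (v : Vec m), ‖f φ v - f φ 0‖ ≤ L * max (‖φ‖ ^ p) 1 * ‖v‖)
    (hk : 1 ≤ k) (hlam : 0 < lam)
    (hGES : ∀ (x₀ : Hist Δ n) (tmax : EReal) (x : ℝ → Vec n),
      IsMaxSolution₀ Δ (fun φ => f φ 0) x₀ tmax x →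
        tmax = ⊤ ∧ ∀ t : ℝ, 0 ≤ t → ‖x t‖ ≤ k * ‖x₀‖ * Real.exp (-lam * t))
    (hτ0 : 0 < τ) (hτ : k * Real.exp (-lam * τ) ≤ 1 / 4) (hT : T = Δ + τ)
    (hD : D = 2 * L * T * Real.exp (2 * L * T)) (hC0 : 0 ≤ C)
    (hC : ∀ S M : ℝ, 0 ≤ S → 0 ≤ M →
      S ^ p * (D * M) ≤ 1 / (8 * k) * S + C * M ^ (1 - p)⁻¹)
    {x : ℝ → Vec n} {u : ℝ → Vec m} {x₀ : Hist Δ n} {tmax : EReal}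
    (hsol : IsSolution Δ f u x₀ tmax x) {t M : ℝ} (ht0 : 0 ≤ t) (ht : (t : EReal) < tmax)
    (hM : 0 ≤ M) (hu : ∀ᵐ s ∂volume, s ∈ Icc 0 t → ‖u s‖ ≤ M) :
    ‖x t‖ ≤ 4 * k * ‖x₀‖ * Real.exp (-(Real.log 2 / T * t)) +
      (8 * k + 2) * (C * M ^ (1 - p)⁻¹ + D * M) := by
  have hΔ : (0 : ℝ) ≤ Δ := Δ.coe_nonneg
  have hT0 : 0 < T := by linarith
  have hD0 : 0 ≤ D := by
    rw [hD]
    positivity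
  set γ := C * M ^ (1 - p)⁻¹ + D * M with hγ
  have hγ0 : 0 ≤ γ := by positivity
  have hcont : ContinuousOn x (Icc (-(Δ : ℝ)) t) := hsol.cont.mono fun s hs =>
    ⟨hs.1, (EReal.coe_le_coe_iff.2 hs.2).trans_lt ht⟩
  have hstep : ∀ a b, 0 ≤ a → a ≤ b → b ≤ t → b - a ≤ T → ∀ s ∈ Icc a b,
      ‖x s‖ ≤ 2 * k * ‖seg Δ x a‖ + 2 * γ ∧
      ‖x s‖ ≤ k * ‖seg Δ x a‖ * Real.exp (-lam * (s - a)) + ‖seg Δ x a‖ / 4 + 2 * γ := by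
    intro a b ha hab hbt hbT
    have hi : ∀ s, 0 ≤ s → s ≤ t →
        IntervalIntegrable (fun s => f (seg Δ x s) (u s)) volume 0 s := fun s hs0 hst =>
      hsol.integrable s hs0 ((EReal.coe_le_coe_iff.2 hst).trans_lt ht)
    have hx : ∀ s, 0 ≤ s → s ≤ t → x s = x 0 + ∫ q in (0 : ℝ)..s, f (seg Δ x q) (u q) :=
      fun s hs0 hst => hsol.integral_eq s hs0 ((EReal.coe_le_coe_iff.2 hst).trans_lt ht)
    refine norm_le_of_short_interval hf0 hL hp0 h1 h2 hk hlam hGES hT0 hD hC0 hC hab hbT hM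
      (hcont.mono (Icc_subset_Icc (by linarith) hbt))
      ((hi a ha (hab.trans hbt)).symm.trans (hi b (ha.trans hab) hbt)) ?_ ?_
    · intro s hs
      have hs0 : 0 ≤ s := ha.trans hs.1
      rw [hx s hs0 (hs.2.trans hbt), hx a ha (hab.trans hbt), add_assoc,
        intervalIntegral.integral_add_adjacent_intervals (hi a ha (hab.trans hbt))
          ((hi a ha (hab.trans hbt)).symm.trans (hi s hs0 (hs.2.trans hbt)))]
    · filter_upwards [hu] with s hs hsab
      exact hs ⟨ha.trans hsab.1, hsab.2.trans hbt⟩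
  have hrec : ∀ j : ℕ, j * T ≤ t → ‖seg Δ x (j * T)‖ ≤ (1 / 2) ^ j * ‖x₀‖ + 4 * γ := by
    intro j
    induction j with
    | zero =>
      intro _
      rw [Nat.cast_zero, zero_mul,
        seg_zero_of_init (hcont.mono (Icc_subset_Icc_right ht0)) hsol.init]
      linarith
    | succ j ih =>
      intro hj
      push_cast at hj ⊢
      have hjT : (0 : ℝ) ≤ j * T := by positivity
      have ih' := ih (by linarith)
      have hs := hstep (j * T) ((j + 1) * T) hjT (by linarith) hj (by linarith)
      set A := ‖seg Δ x (j * T)‖ with hA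
      have hA0 : 0 ≤ A := norm_nonneg _
      have h : ‖seg Δ x ((j + 1) * T)‖ ≤ A / 2 + 2 * γ := by
        refine norm_seg_le (by positivity)
          (hcont.mono (Icc_subset_Icc (by linarith) hj)) fun s hs' => ?_
        have e1 := (hs s ⟨by linarith [hs'.1], hs'.2⟩).2
        have e2 : Real.exp (-lam * (s - j * T)) ≤ Real.exp (-lam * τ) := by
          have : τ ≤ s - j * T := by linarith [hs'.1]
          exact Real.exp_le_exp.2 (by nlinarith)
        have e3 : k * A * Real.exp (-lam * (s - j * T)) ≤ 1 / 4 * A := by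
          calc k * A * Real.exp (-lam * (s - j * T))
              ≤ k * A * Real.exp (-lam * τ) := by gcongr
            _ = k * Real.exp (-lam * τ) * A := by ring
            _ ≤ 1 / 4 * A := by gcongr
        linarith
      rw [pow_succ]
      linarith
  have hj1 : (⌊t / T⌋₊ : ℝ) * T ≤ t := (le_div_iff₀ hT0).1 (Nat.floor_le (by positivity))
  have hj2 : t < ((⌊t / T⌋₊ : ℝ) + 1) * T := (div_lt_iff₀ hT0).1 (Nat.lt_floor_add_one _)
  set j := ⌊t / T⌋₊ with hj
  have hlast := (hstep (j * T) t (by positivity) hj1 le_rfl (by linarith) t ⟨hj1, le_rfl⟩).1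
  have hexp : (1 / 2 : ℝ) ^ j ≤ 2 * Real.exp (-(Real.log 2 / T * t)) := by
    have e1 : Real.exp (-(Real.log 2 * (j + 1))) ≤ Real.exp (-(Real.log 2 / T * t)) := by
      rw [Real.exp_le_exp, neg_le_neg_iff, div_mul_eq_mul_div, div_le_iff₀ hT0, mul_assoc]
      exact mul_le_mul_of_nonneg_left hj2.le (Real.log_nonneg one_le_two)
    have e2 : Real.exp (-(Real.log 2 * (j + 1))) = (1 / 2) ^ (j + 1) := by
      rw [Real.exp_neg, Real.exp_mul, Real.exp_log two_pos, one_div, inv_pow]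
      exact_mod_cast rfl
    rw [e2, pow_succ] at e1
    linarith
  have e1 := mul_le_mul_of_nonneg_right hexp (norm_nonneg x₀)
  have e2 := mul_le_mul_of_nonneg_left ((hrec j hj1).trans (add_le_add_left e1 (4 * γ)))
    (by linarith : 0 ≤ 2 * k)
  linarith

theorem IsInput.essBnd_spec {m : ℕ} {u : ℝ → Vec m} (hu : IsInput u) {t : ℝ} (ht : 0 ≤ t) :
    0 ≤ essBnd u (Icc 0 t) ∧ ∀ᵐ s ∂volume, s ∈ Icc 0 t → ‖u s‖ ≤ essBnd u (Icc 0 t) := by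
  have hne : {C : ℝ | 0 ≤ C ∧ ∀ᵐ s ∂volume, s ∈ Icc 0 t → ‖u s‖ ≤ C}.Nonempty := by
    obtain ⟨C, hC⟩ := hu.2 (t + 1) (by linarith)
    refine ⟨max C 0, le_max_right _ _, ?_⟩
    filter_upwards [hC] with s hs hst
    exact (hs ⟨hst.1, by linarith [hst.2]⟩).trans (le_max_left _ _)
  refine ⟨le_csInf hne fun C hC => hC.1, ?_⟩
  have h : ∀ j : ℕ, ∀ᵐ s ∂volume, s ∈ Icc 0 t →
      ‖u s‖ ≤ essBnd u (Icc 0 t) + 1 / ((j : ℝ) + 1) := by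
    intro j
    obtain ⟨C, hC, hlt⟩ := exists_lt_of_csInf_lt hne
      (lt_add_of_pos_right (essBnd u (Icc 0 t)) (by positivity : 0 < 1 / ((j : ℝ) + 1)))
    filter_upwards [hC.2] with s hs hst
    exact (hs hst).trans hlt.le
  filter_upwards [ae_all_iff.2 h] with s hs hst
  have hlim : Tendsto (fun j : ℕ => essBnd u (Icc 0 t) + 1 / ((j : ℝ) + 1)) atTop
      (𝓝 (essBnd u (Icc 0 t) + 0)) :=
    tendsto_const_nhds.add tendsto_one_div_add_atTop_nhds_zero_nat
  rw [add_zero] at hlim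
  exact ge_of_tendsto' hlim fun j => hs j hst

theorem classKL_mul_exp_neg {k c : ℝ} (hk : 0 < k) (hc : 0 < c) :
    ClassKL fun s t => k * s * Real.exp (-(c * t)) := by
  refine ⟨fun t _ => ⟨by fun_prop, fun s _ s' _ h => ?_, by simp⟩,
    fun s hs => ⟨by fun_prop, fun t _ t' _ h => ?_, ?_⟩⟩
  · have := Real.exp_pos (-(c * t))
    change k * s * _ < k * s' * _
    gcongr
  · have : 0 ≤ s := hs
    change k * s * _ ≤ k * s * _
    gcongr
  · have h : Tendsto (fun t : ℝ => Real.exp (-(c * t))) atTop (𝓝 0) :=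
      Real.tendsto_exp_neg_atTop_nhds_zero.comp (tendsto_id.const_mul_atTop hc)
    simpa using h.const_mul (k * s)

theorem classN_rpow_add_linear {A C D q : ℝ} (hA : 0 ≤ A) (hC : 0 ≤ C) (hD : 0 ≤ D)
    (hq : 0 < q) : ClassN fun M => A * (C * M ^ q + D * M) := by
  refine ⟨?_, fun M hM M' _ h => ?_, ?_⟩
  · have : Continuous fun M : ℝ => M ^ q := Real.continuous_rpow_const hq.le
    exact Continuous.continuousOn (by fun_prop)
  · have : 0 ≤ M := hM
    change A * (C * M ^ q + D * M) ≤ A * (C * M' ^ q + D * M')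
    gcongr
  · simp [Real.zero_rpow hq.ne']

/-- For globally Lipschitz systems, 0-GES implies ISS. -/
theorem iss_of_zero_ges_globally_lipschitz
    (Δ : ℝ≥0) (n m : ℕ) (f : Hist Δ n → Vec m → Vec n)
    (hf : LipOnBounded f) (hf0 : f 0 0 = 0)
    (L p : ℝ) (hL : 0 < L) (hp0 : 0 ≤ p) (hp1 : p < 1)
    (h1 : ∀ φ ψ : Hist Δ n, ‖f φ 0 - f ψ 0‖ ≤ L * ‖φ - ψ‖)
    (h2 : ∀ (φ : Hist Δ n) (v : Vec m), ‖f φ v - f φ 0‖ ≤ L * max (‖φ‖ ^ p) 1 * ‖v‖)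
    (hGES : GES Δ (fun φ => f φ 0)) :
    ISS Δ f := by
  obtain ⟨k, hk, lam, hlam, hGES⟩ := hGES
  have hk0 : 0 < k := by linarith
  have hτ0 : 0 < Real.log (4 * k) / lam := div_pos (Real.log_pos (by linarith)) hlam
  set τ := Real.log (4 * k) / lam with hτdef
  have hτ : k * Real.exp (-lam * τ) ≤ 1 / 4 := by
    have e1 : -lam * τ = -Real.log (4 * k) := by
      rw [hτdef]
      field_simp
    rw [e1, Real.exp_neg, Real.exp_log (by positivity)]
    apply le_of_eq
    field_simp
  obtain ⟨T, hT⟩ : ∃ T : ℝ, T = Δ + τ := ⟨_, rfl⟩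
  have hT0 : 0 < T := by
    have : (0 : ℝ) ≤ Δ := Δ.coe_nonneg
    linarith
  obtain ⟨D, hD⟩ : ∃ D : ℝ, D = 2 * L * T * Real.exp (2 * L * T) := ⟨_, rfl⟩
  have hD0 : 0 ≤ D := by
    rw [hD]
    positivity
  obtain ⟨C, hC0, hC⟩ := exists_rpow_mul_le_add hp0 hp1 hD0
    (by positivity : 0 < 1 / (8 * k))
  have hβ := classKL_mul_exp_neg (by positivity : 0 < 4 * k)
    (div_pos (Real.log_pos one_lt_two) hT0)
  have hμ := classN_rpow_add_linear (by positivity : 0 ≤ 8 * k + 2) hC0 hD0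
    (inv_pos.2 (by linarith : 0 < 1 - p))
  refine ⟨_, _, hβ, hμ, fun x₀ u tmax x hu hx => ?_⟩
  have hest : ∀ t M : ℝ, 0 ≤ t → (t : EReal) < tmax → 0 ≤ M →
      (∀ᵐ s ∂volume, s ∈ Icc 0 t → ‖u s‖ ≤ M) →
      ‖x t‖ ≤ 4 * k * ‖x₀‖ * Real.exp (-(Real.log 2 / T * t)) +
        (8 * k + 2) * (C * M ^ (1 - p)⁻¹ + D * M) := fun t M ht0 ht hM hM' =>
    hx.1.norm_le hf0 hL hp0 h1 h2 hk hlam hGES hτ0 hτ hT hD hC0 hC ht0 ht hM hM'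
  have htop : tmax = ⊤ := by
    by_contra hne
    have hb : ((tmax.toReal : ℝ) : EReal) = tmax :=
      EReal.coe_toReal hne (ne_bot_of_gt hx.1.tmax_pos)
    have hb0 : 0 ≤ tmax.toReal := EReal.toReal_nonneg hx.1.tmax_pos.le
    obtain ⟨hM, hM'⟩ := hu.essBnd_spec hb0
    set M := essBnd u (Icc 0 tmax.toReal)
    refine hne (hx.eq_top_of_bounded hf hu
      (R := max ‖x₀‖ (4 * k * ‖x₀‖ + (8 * k + 2) * (C * M ^ (1 - p)⁻¹ + D * M))) ?_)
    intro t ht htb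
    rcases le_total t 0 with h | h
    · rw [hx.1.init ⟨t, ht, h⟩]
      exact (x₀.norm_coe_le_norm _).trans (le_max_left _ _)
    · have htb' : t < tmax.toReal := by
        rw [← hb] at htb
        exact EReal.coe_lt_coe_iff.1 htb
      have e1 := hest t M h htb hM (by
        filter_upwards [hM'] with s hs hst
        exact hs ⟨hst.1, hst.2.trans htb'.le⟩)
      have e2 : Real.exp (-(Real.log 2 / T * t)) ≤ 1 := by
        rw [Real.exp_le_one_iff, neg_nonpos]
        have := Real.log_nonneg one_le_two
        positivity
      have e3 := mul_le_mul_of_nonneg_left e2 (by positivity : 0 ≤ 4 * k * ‖x₀‖)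
      exact le_trans (by linarith) (le_max_right _ _)
  refine ⟨htop, fun t ht0 => ?_⟩
  obtain ⟨hM, hM'⟩ := hu.essBnd_spec ht0
  exact hest t _ ht0 (htop ▸ EReal.coe_lt_top t) hM hM'
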